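/- Let 1/n ≪ 1/C' ≪ 1/C ≪ ε, where n ∈ ℕ. If G = (V_1, V_2) is a bipartite graph with |V_1| = |V_2| = n such that δ_{1}(G) + δ_{2}(G) ≥ (1 + ε)n, then there exists a probability distribution over partitions U = {U_1, …, U_m} of V(G) satisfying: (1) |U_i ∩ V_1| = |U_i ∩ V_2| for each i ∈ [m], |U_i| = 2C for each 2 ≤ i ≤ m, and |U_1| equals 2(C−1)C plus the remainder when 2n is divided by 2(C−1)C; (2) δ_{1}(G[U_i]) + δ_{2}(G[U_i]) ≥ (1 + ε/3)·|U_i|/2 for each i ∈ [m]; (3) for every set of distinct vertices y_1, …, y_s ∈ V(G) and every function f: [s] → [m], the probability that y_i ∈ U_{f(i)} for each i ∈ [s] is at most (C'/n)^s. -/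

import Mathlib

/-- The outcomes that avoid every event `B i` with `i ∈ S`. -/
def avoiding {Ω ι : Type*} [Fintype Ω] [DecidableEq Ω] [DecidableEq ι]
    (B : ι → Finset Ω) (S : Finset ι) : Finset Ω :=
  Finset.univ \ S.biUnion B

section LocalLemma

variable {Ω ι : Type*} [Fintype Ω] [DecidableEq Ω] [DecidableEq ι] {B : ι → Finset Ω}

lemma mem_avoiding {S : Finset ι} {ω : Ω} : ω ∈ avoiding B S ↔ ∀ i ∈ S, ω ∉ B i := by
  simp [avoiding]

lemma avoiding_anti {S T : Finset ι} (h : S ⊆ T) : avoiding B T ⊆ avoiding B S :=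
  Finset.sdiff_subset_sdiff (Finset.Subset.refl _) (Finset.biUnion_subset_biUnion_of_subset_left _ h)

lemma card_avoiding_le_add_sum (S T : Finset ι) :
    (avoiding B S).card ≤
      (avoiding B (S ∪ T)).card + ∑ j ∈ T, (B j ∩ avoiding B S).card := by
  have h : avoiding B S ⊆ avoiding B (S ∪ T) ∪ T.biUnion fun j => B j ∩ avoiding B S := by
    intro ω hω
    by_cases hT : ∃ j ∈ T, ω ∈ B j
    · obtain ⟨j, hj, hω'⟩ := hT
      exact Finset.mem_union_right _
        (Finset.mem_biUnion.2 ⟨j, hj, Finset.mem_inter.2 ⟨hω', hω⟩⟩)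
    · push Not at hT
      refine Finset.mem_union_left _ (mem_avoiding.2 fun i hi => ?_)
      rcases Finset.mem_union.1 hi with hi | hi
      exacts [mem_avoiding.1 hω i hi, hT i hi]
  calc _ ≤ _ := Finset.card_le_card h
    _ ≤ _ := Finset.card_union_le _ _
    _ ≤ _ := Nat.add_le_add_left Finset.card_biUnion_le _

/-- If the conditional probability of each `B j` with `j ∈ T` given `avoiding B S` is at most
`2 p j`, and these bounds add up to at most `1 / 2`, then avoiding `T` as well loses at most a
factor of two. -/
lemma card_avoiding_le_two_mul {p : ι → ℝ} {S T : Finset ι}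
    (h : ∀ j ∈ T, ((B j ∩ avoiding B S).card : ℝ) ≤ 2 * p j * (avoiding B S).card)
    (hT : ∑ j ∈ T, p j ≤ 1 / 4) :
    ((avoiding B S).card : ℝ) ≤ 2 * (avoiding B (S ∪ T)).card := by
  have h1 : ((avoiding B S).card : ℝ) ≤
      (avoiding B (S ∪ T)).card + ∑ j ∈ T, ((B j ∩ avoiding B S).card : ℝ) := by
    exact_mod_cast card_avoiding_le_add_sum S T
  have h2 : ∑ j ∈ T, ((B j ∩ avoiding B S).card : ℝ) ≤ 1 / 2 * (avoiding B S).card := by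
    calc _ ≤ ∑ j ∈ T, 2 * p j * ((avoiding B S).card : ℝ) := Finset.sum_le_sum h
      _ = 2 * (∑ j ∈ T, p j) * ((avoiding B S).card : ℝ) := by
        rw [Finset.mul_sum, Finset.sum_mul]
      _ ≤ _ := by gcongr; linarith
  linarith

variable {p : ι → ℝ} {r : ι → ι → Prop} [DecidableRel r] {I : Finset ι}

/-- The lopsided Lovász local lemma, for the uniform measure on a finite set. -/
theorem lopsided_local_lemma
    (h : ∀ i ∈ I, ∀ S ⊆ I, (∀ j ∈ S, ¬ r i j) →
      ((B i ∩ avoiding B S).card : ℝ) ≤ p i * (avoiding B S).card)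
    (hp : ∀ i, 0 ≤ p i)
    (hsum : ∀ i ∈ I, ∑ j ∈ I.filter (r i), p j ≤ 1 / 4) (S : Finset ι) (hS : S ⊆ I) :
    ∀ i ∈ I, ((B i ∩ avoiding B S).card : ℝ) ≤ 2 * p i * (avoiding B S).card := by
  induction S using Finset.strongInduction with
  | H S ih =>
    intro i hi
    have hsub : S.filter (fun j => ¬ r i j) ⊆ S := Finset.filter_subset _ _
    have key : ((avoiding B (S.filter (fun j => ¬ r i j))).card : ℝ) ≤
        2 * (avoiding B S).card := by
      rcases hsub.eq_or_ssubset with heq | hss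
      · rw [heq]
        have : (0 : ℝ) ≤ ((avoiding B S).card : ℝ) := Nat.cast_nonneg _
        linarith
      · have hu : S.filter (fun j => ¬ r i j) ∪ S.filter (r i) = S := by
          rw [Finset.union_comm, Finset.filter_union_filter_not_eq]
        have := card_avoiding_le_two_mul (B := B) (p := p) (S := S.filter (fun j => ¬ r i j))
          (T := S.filter (r i))
          (fun j hj => ih _ hss (hsub.trans hS) j (hS (Finset.mem_filter.1 hj).1))
          ((Finset.sum_le_sum_of_subset_of_nonneg (Finset.filter_subset_filter _ hS)
            (fun j _ _ => hp j)).trans (hsum i hi))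
        rwa [hu] at this
    have h1 : ((B i ∩ avoiding B S).card : ℝ) ≤
        ((B i ∩ avoiding B (S.filter (fun j => ¬ r i j))).card : ℝ) := by
      exact_mod_cast Finset.card_le_card
        (Finset.inter_subset_inter_left (avoiding_anti hsub))
    have h2 := h i hi _ (hsub.trans hS) (fun j hj => (Finset.mem_filter.1 hj).2)
    have h3 := mul_le_mul_of_nonneg_left key (hp i)
    linarith

/-- Under the hypotheses of the local lemma, avoiding finitely many light families of events costs
at most a factor of two per family. -/
theorem card_avoiding_le_two_pow_mul {τ : Type*} [DecidableEq τ]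
    (h : ∀ S ⊆ I, ∀ i ∈ I, ((B i ∩ avoiding B S).card : ℝ) ≤ 2 * p i * (avoiding B S).card)
    {S : Finset ι} (hS : S ⊆ I) (R : Finset τ) (Γ : τ → Finset ι) (hΓ : ∀ t ∈ R, Γ t ⊆ I)
    (hsum : ∀ t ∈ R, ∑ j ∈ Γ t, p j ≤ 1 / 4) :
    ((avoiding B S).card : ℝ) ≤ 2 ^ R.card * (avoiding B (S ∪ R.biUnion Γ)).card := by
  induction R using Finset.induction_on with
  | empty => simp
  | insert t R ht ih =>
    have h1 := ih (fun u hu => hΓ u (Finset.mem_insert_of_mem hu))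
      (fun u hu => hsum u (Finset.mem_insert_of_mem hu))
    have hsub : S ∪ R.biUnion Γ ⊆ I := Finset.union_subset hS
      (Finset.biUnion_subset.2 fun u hu => hΓ u (Finset.mem_insert_of_mem hu))
    have h2 := card_avoiding_le_two_mul (B := B) (p := p) (S := S ∪ R.biUnion Γ) (T := Γ t)
      (fun j hj => h _ hsub j (hΓ t (Finset.mem_insert_self _ _) hj))
      (hsum t (Finset.mem_insert_self _ _))
    have h3 : S ∪ R.biUnion Γ ∪ Γ t = S ∪ (insert t R).biUnion Γ := by
      rw [Finset.biUnion_insert, Finset.union_assoc, Finset.union_comm (R.biUnion Γ)]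
    rw [h3] at h2
    rw [Finset.card_insert_of_notMem ht, pow_succ, mul_assoc]
    exact h1.trans (by gcongr)

end LocalLemma

/-- The tuples of bijections `X ≃ Y` that contain all the prescribed atoms `(b, x, y) ∈ E`, meaning
that the `b`-th bijection sends `x` to `y`. -/
def extending {β X Y : Type*} [Fintype β] [DecidableEq β] [Fintype X] [DecidableEq X] [Fintype Y]
    [DecidableEq Y] (E : Finset (β × X × Y)) : Finset (β → X ≃ Y) :=
  Finset.univ.filter fun ω => ∀ e ∈ E, ω e.1 e.2.1 = e.2.2

section Extending

variable {β X Y ι : Type*} [Fintype β] [DecidableEq β] [Fintype X] [DecidableEq X] [Fintype Y]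
  [DecidableEq Y] [DecidableEq ι]

lemma mem_extending {E : Finset (β × X × Y)} {ω : β → X ≃ Y} :
    ω ∈ extending E ↔ ∀ e ∈ E, ω e.1 e.2.1 = e.2.2 := by
  simp [extending]

/-- Two sets of atoms are independent if they share neither a point of the domain nor a value. -/
def Independent (E F : Finset (β × X × Y)) : Prop :=
  ∀ e ∈ E, ∀ f ∈ F, e.1 = f.1 → e.2.1 ≠ f.2.1 ∧ e.2.2 ≠ f.2.2

lemma card_extending_insert_mul_le {F : ι → Finset (β × X × Y)} {S : Finset ι}
    {E : Finset (β × X × Y)} {e : β × X × Y} (he : e ∉ E)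
    (hF : ∀ i ∈ S, Independent (insert e E) (F i)) :
    (extending (insert e E) ∩ avoiding (fun i => extending (F i)) S).card *
        (Fintype.card Y - (E.filter fun a => a.1 = e.1).card) ≤
      (extending E ∩ avoiding (fun i => extending (F i)) S).card := by
  classical
  obtain ⟨b, x, v⟩ := e
  set R : Finset Y := Finset.univ \ (E.filter fun a => a.1 = b).image fun a => a.2.2 with hR
  have hRcard : Fintype.card Y - (E.filter fun a => a.1 = b).card ≤ R.card := by
    rw [hR, Finset.card_sdiff_of_subset (Finset.subset_univ _), Finset.card_univ]
    exact Nat.sub_le_sub_left Finset.card_image_le _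
  refine (Nat.mul_le_mul_left _ hRcard).trans ?_
  rw [← Finset.card_product]
  refine Finset.card_le_card_of_injOn
    (fun q => Function.update q.1 b ((q.1 b).trans (Equiv.swap v q.2))) ?_ ?_
  · rintro ⟨ω, u⟩ hq
    simp only [Finset.coe_product, Set.mem_prod, Finset.mem_coe, Finset.mem_inter, mem_extending,
      mem_avoiding] at hq
    obtain ⟨⟨hω, hav⟩, hu⟩ := hq
    have hxv : ω b x = v := hω _ (Finset.mem_insert_self _ _)
    have hu' : ∀ a ∈ E, a.1 = b → a.2.2 ≠ u := by
      intro a ha hab hau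
      rw [hR, Finset.mem_sdiff] at hu
      exact hu.2 (Finset.mem_image.2 ⟨a, Finset.mem_filter.2 ⟨ha, hab⟩, hau⟩)
    simp only [Finset.mem_coe, Finset.mem_inter, mem_extending, mem_avoiding]
    refine ⟨?_, ?_⟩
    · rintro ⟨b', x', v'⟩ ha
      have h1 : ω b' x' = v' := hω _ (Finset.mem_insert_of_mem ha)
      by_cases hb : b' = b
      · subst hb
        simp only [Function.update_self, Equiv.trans_apply, h1]
        refine Equiv.swap_apply_of_ne_of_ne ?_ (hu' _ ha rfl)
        rintro rfl
        have : x' = x := (ω b').injective (h1.trans hxv.symm)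
        exact he (this ▸ ha)
      · simp only [Function.update_of_ne hb, h1]
    · intro i hi hcon
      refine hav i hi fun f hf => ?_
      have h2 := hcon f hf
      by_cases hb : f.1 = b
      · have h3 := hF i hi _ (Finset.mem_insert_self _ _) f hf hb.symm
        rw [hb] at h2 ⊢
        simp only [Function.update_self, Equiv.trans_apply] at h2
        have hne : ω b f.2.1 ≠ v := fun h => h3.1 ((ω b).injective (hxv.trans h.symm))
        have hne' : ω b f.2.1 ≠ u := by
          intro h
          rw [h, Equiv.swap_apply_right] at h2
          exact h3.2 h2
        rwa [Equiv.swap_apply_of_ne_of_ne hne hne'] at h2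
      · simpa only [Function.update_of_ne hb] using h2
  · rintro ⟨ω, u⟩ hq ⟨ω', u'⟩ hq' heq
    simp only [Finset.coe_product, Set.mem_prod, Finset.mem_coe, Finset.mem_inter,
      mem_extending] at hq hq'
    have hxv : ω b x = v := hq.1.1 _ (Finset.mem_insert_self _ _)
    have hxv' : ω' b x = v := hq'.1.1 _ (Finset.mem_insert_self _ _)
    simp only at heq
    have hb := congrFun heq b
    simp only [Function.update_self] at hb
    have huu : u = u' := by
      have := congrArg (fun σ : X ≃ Y => σ x) hb
      simpa [hxv, hxv'] using this
    subst huu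
    refine Prod.ext (funext fun c => ?_) rfl
    by_cases hc : c = b
    · subst hc
      ext z
      have := congrArg (fun σ : X ≃ Y => σ z) hb
      simpa using this
    · simpa only [Function.update_of_ne hc] using congrFun heq c

/-- For uniformly random bijections, an event of the form `extending E` is at most as likely
conditionally on avoiding independent events of the same form as it is unconditionally. -/
theorem card_extending_mul_prod_descFactorial_le {F : ι → Finset (β × X × Y)} {S : Finset ι}
    (E : Finset (β × X × Y)) (hF : ∀ i ∈ S, Independent E (F i)) :
    (extending E ∩ avoiding (fun i => extending (F i)) S).card *
        ∏ b, (Fintype.card Y).descFactorial (E.filter fun a => a.1 = b).card ≤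
      (avoiding (fun i => extending (F i)) S).card := by
  induction E using Finset.induction_on with
  | empty => simpa using Finset.card_le_card Finset.inter_subset_right
  | insert e E he ih =>
    have h1 := card_extending_insert_mul_le he hF
    have h2 := ih fun i hi a ha => hF i hi a (Finset.mem_insert_of_mem ha)
    have hprod : ∏ b, (Fintype.card Y).descFactorial ((insert e E).filter fun a => a.1 = b).card =
        (Fintype.card Y - (E.filter fun a => a.1 = e.1).card) *
          ∏ b, (Fintype.card Y).descFactorial (E.filter fun a => a.1 = b).card := by
      rw [← Finset.mul_prod_erase _ _ (Finset.mem_univ e.1),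
        ← Finset.mul_prod_erase Finset.univ
          (fun b => (Fintype.card Y).descFactorial (E.filter fun a => a.1 = b).card)
          (Finset.mem_univ e.1), ← mul_assoc]
      congr 1
      · rw [Finset.filter_insert, if_pos rfl, Finset.card_insert_of_notMem
          (fun h => he (Finset.mem_filter.1 h).1), Nat.descFactorial_succ]
      · refine Finset.prod_congr rfl fun b hb => ?_
        rw [Finset.filter_insert, if_neg (Finset.ne_of_mem_erase hb).symm]
    rw [hprod, ← mul_assoc]
    exact (Nat.mul_le_mul_right _ h1).trans h2

end Extending

lemma pow_le_exp_mul_descFactorial (a n : ℕ) (h : a ≤ n) :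
    (n : ℝ) ^ a ≤ Real.exp 1 ^ a * n.descFactorial a := by
  induction a generalizing n with
  | zero => simp
  | succ a ih =>
    obtain ⟨n, rfl⟩ : ∃ k, n = k + 1 := ⟨n - 1, by omega⟩
    have han : a ≤ n := by omega
    have h1 := ih n han
    have h2 : ((n : ℝ) + 1) ^ a ≤ Real.exp 1 * (n : ℝ) ^ a := by
      rcases Nat.eq_zero_or_pos n with rfl | hn
      · have : a = 0 := by omega
        subst this
        simp
      have hn' : (0 : ℝ) < n := by exact_mod_cast hn
      have h3 : ((n : ℝ) + 1) ≤ Real.exp (1 / n) * n := by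
        have := Real.add_one_le_exp (1 / (n : ℝ))
        calc ((n : ℝ) + 1) = (1 / n + 1) * n := by
              rw [add_mul, one_mul, div_mul_cancel₀ _ hn'.ne', add_comm]
          _ ≤ _ := by gcongr
      calc ((n : ℝ) + 1) ^ a ≤ (Real.exp (1 / n) * n) ^ a := by gcongr
        _ = Real.exp (a * (1 / n)) * (n : ℝ) ^ a := by rw [mul_pow, ← Real.exp_nat_mul]
        _ ≤ _ := by
          gcongr
          rw [mul_one_div]
          exact div_le_one_of_le₀ (by exact_mod_cast han) hn'.le
    rw [Nat.succ_descFactorial_succ]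
    push_cast
    calc ((n : ℝ) + 1) ^ (a + 1) = ((n : ℝ) + 1) ^ a * (n + 1) := pow_succ _ _
      _ ≤ (Real.exp 1 * (Real.exp 1 ^ a * n.descFactorial a)) * (n + 1) := by
        gcongr
        exact h2.trans (by gcongr)
      _ = _ := by ring

lemma pow_le_two_mul_descFactorial {k n : ℕ} (h : 2 * k ^ 2 ≤ n) :
    (n : ℝ) ^ k ≤ 2 * n.descFactorial k := by
  rcases Nat.eq_zero_or_pos n with rfl | hn
  · have : k = 0 := by nlinarith
    subst this
    norm_num
  have hn' : (0 : ℝ) < n := by exact_mod_cast hn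
  have hkn : k ≤ n := by nlinarith
  have h1 : ((n : ℝ) - k) ^ k ≤ n.descFactorial k := by
    rw [← Nat.cast_sub hkn]
    exact_mod_cast (Nat.pow_le_pow_left (by omega) k).trans (Nat.pow_sub_le_descFactorial n k)
  have h' : (2 : ℝ) * k ^ 2 ≤ n := by exact_mod_cast h
  have hk1 : (k : ℝ) / n ≤ 1 := div_le_one_of_le₀ (by exact_mod_cast hkn) hn'.le
  have h2 := one_add_mul_le_pow (a := -((k : ℝ) / n)) (by linarith) k
  have h3 : (k : ℝ) * (k / n) ≤ 1 / 2 := by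
    rw [← mul_div_assoc, div_le_iff₀ hn']
    nlinarith
  have h4 : ((n : ℝ) - k) ^ k = n ^ k * (1 + -((k : ℝ) / n)) ^ k := by
    rw [← mul_pow]
    congr 1
    field_simp
    ring
  have h5 : (0 : ℝ) < (n : ℝ) ^ k := by positivity
  nlinarith

section Tail

variable {κ Y : Type*} [Fintype κ] [DecidableEq κ] [Fintype Y] [DecidableEq Y]

lemma sum_exp_le (N : Finset Y) {l : ℝ} (hl0 : 0 ≤ l) (hl : l ≤ 1) :
    ∑ v : Y, Real.exp (l * (N.card / Fintype.card Y - if v ∈ N then 1 else 0)) ≤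
      Fintype.card Y * Real.exp (l ^ 2) := by
  rcases isEmpty_or_nonempty Y with hY | hY
  · simp
  have hn : (0 : ℝ) < Fintype.card Y := by exact_mod_cast Fintype.card_pos
  set q : ℝ := N.card / Fintype.card Y with hq
  have hq0 : 0 ≤ q := by positivity
  have hq1 : q ≤ 1 := div_le_one_of_le₀ (by exact_mod_cast Finset.card_le_univ N) hn.le
  have h1 : ∀ v : Y, Real.exp (l * (q - if v ∈ N then 1 else 0)) ≤
      1 + l * (q - if v ∈ N then 1 else 0) + l ^ 2 := by
    intro v
    have hx : |q - if v ∈ N then (1 : ℝ) else 0| ≤ 1 := by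
      rw [abs_le]
      split_ifs <;> constructor <;> linarith
    have hx' : |l * (q - if v ∈ N then (1 : ℝ) else 0)| ≤ l := by
      rw [abs_mul, abs_of_nonneg hl0]
      exact mul_le_of_le_one_right hl0 hx
    have h2 := (abs_le.1 (Real.abs_exp_sub_one_sub_id_le (hx'.trans hl))).2
    have h3 : (l * (q - if v ∈ N then (1 : ℝ) else 0)) ^ 2 ≤ l ^ 2 := by
      rw [← sq_abs (l * _)]
      gcongr
    linarith
  calc _ ≤ ∑ v : Y, (1 + l * (q - if v ∈ N then 1 else 0) + l ^ 2) :=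
        Finset.sum_le_sum fun v _ => h1 v
    _ = Fintype.card Y * (1 + l ^ 2) := by
      rw [Finset.sum_add_distrib, Finset.sum_add_distrib, ← Finset.mul_sum,
        Finset.sum_sub_distrib]
      simp only [Finset.sum_const, Finset.card_univ, nsmul_eq_mul, Finset.sum_boole,
        Finset.filter_univ_mem, hq]
      field_simp
      ring
    _ ≤ _ := by
      gcongr
      linarith [Real.add_one_le_exp (l ^ 2)]

/-- A Chernoff bound for the number of coordinates of a uniformly random function that fall into
`N`, given the value of one coordinate. -/
lemma card_lower_tail_fixed_le (N : Finset Y) {l η : ℝ} (hl0 : 0 ≤ l) (hl : l ≤ 1)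
    (x : κ) (v : Y) :
    ((Finset.univ.filter fun w : κ → Y => w x = v ∧
        ((Finset.univ.filter fun y => w y ∈ N).card : ℝ) <
          (N.card / Fintype.card Y - η) * Fintype.card κ).card : ℝ) ≤
      Real.exp (1 + l ^ 2 * Fintype.card κ - l * η * Fintype.card κ) *
        (Fintype.card Y : ℝ) ^ (Fintype.card κ - 1) := by
  have hn : (0 : ℝ) < Fintype.card Y := by exact_mod_cast Fintype.card_pos_iff.2 ⟨v⟩
  set q : ℝ := N.card / Fintype.card Y with hq
  set k := Fintype.card κ with hk
  have hq1 : q ≤ 1 := div_le_one_of_le₀ (by exact_mod_cast Finset.card_le_univ N) hn.le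
  let φ : Y → ℝ := fun u => Real.exp (l * (q - if u ∈ N then 1 else 0))
  let c : κ → Y → ℝ := fun y u => (if y = x then (if u = v then 1 else 0) else 1) * φ u
  have hφ : ∀ u, 0 < φ u := fun u => Real.exp_pos _
  have hc0 : ∀ y u, 0 ≤ c y u := fun y u =>
    mul_nonneg (by split_ifs <;> norm_num) (hφ u).le
  have hprod : ∀ w : κ → Y, w x = v →
      ((Finset.univ.filter fun y => w y ∈ N).card : ℝ) < (q - η) * k →
      Real.exp (l * η * k) ≤ ∏ y, c y (w y) := by
    intro w hw hlt
    have h1 : ∏ y, c y (w y) = ∏ y, φ (w y) := by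
      refine Finset.prod_congr rfl fun y _ => ?_
      by_cases hy : y = x
      · subst hy
        simp [c, hw]
      · simp [c, hy]
    rw [h1, ← Real.exp_sum, ← Finset.mul_sum, Finset.sum_sub_distrib, Finset.sum_boole]
    simp only [Finset.sum_const, Finset.card_univ, nsmul_eq_mul, ← hk]
    rw [Real.exp_le_exp, mul_assoc]
    gcongr
    linarith
  have hsum : ∑ w : κ → Y, ∏ y, c y (w y) ≤
      Real.exp (1 + l ^ 2 * k) * (Fintype.card Y : ℝ) ^ (k - 1) := by
    have h1 : ∑ w : κ → Y, ∏ y, c y (w y) = ∏ y, ∑ u, c y u := by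
      rw [Finset.prod_univ_sum, Fintype.piFinset_univ]
    rw [h1, ← Finset.mul_prod_erase _ _ (Finset.mem_univ x)]
    have h2 : ∑ u, c x u ≤ Real.exp 1 := by
      have : ∑ u, c x u = φ v := by simp [c]
      rw [this]
      refine Real.exp_le_exp.2 ?_
      have : (q - if v ∈ N then (1 : ℝ) else 0) ≤ 1 := by split_ifs <;> linarith
      nlinarith
    have h3 : ∏ y ∈ Finset.univ.erase x, ∑ u, c y u ≤
        (Fintype.card Y * Real.exp (l ^ 2)) ^ (k - 1) := by
      have hcard : (Finset.univ.erase x).card = k - 1 := by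
        rw [Finset.card_erase_of_mem (Finset.mem_univ x), Finset.card_univ]
      rw [← hcard, ← Finset.prod_const]
      refine Finset.prod_le_prod (fun y _ => Finset.sum_nonneg fun u _ => hc0 y u) fun y hy => ?_
      have : ∑ u, c y u = ∑ u, φ u := by simp [c, Finset.ne_of_mem_erase hy]
      rw [this]
      exact sum_exp_le N hl0 hl
    have h4 : Real.exp (l ^ 2) ^ (k - 1) ≤ Real.exp (l ^ 2 * k) := by
      rw [← Real.exp_nat_mul, mul_comm]
      gcongr
      exact Nat.sub_le _ _
    calc _ ≤ Real.exp 1 * (Fintype.card Y * Real.exp (l ^ 2)) ^ (k - 1) := by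
          gcongr
      _ ≤ _ := by
        rw [mul_pow, Real.exp_add]
        calc _ = Real.exp 1 * Real.exp (l ^ 2) ^ (k - 1) * (Fintype.card Y : ℝ) ^ (k - 1) := by ring
          _ ≤ _ := by gcongr
  set W := Finset.univ.filter fun w : κ → Y => w x = v ∧
        ((Finset.univ.filter fun y => w y ∈ N).card : ℝ) < (q - η) * k with hW
  have h5 : (W.card : ℝ) * Real.exp (l * η * k) ≤ ∑ w : κ → Y, ∏ y, c y (w y) := by
    rw [← nsmul_eq_mul]
    refine (Finset.card_nsmul_le_sum W _ _ fun w hw => ?_).trans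
      (Finset.sum_le_sum_of_subset_of_nonneg (Finset.subset_univ W)
        fun w _ _ => Finset.prod_nonneg fun y _ => hc0 y _)
    have hw' := (Finset.mem_filter.1 hw).2
    exact hprod w hw'.1 hw'.2
  rw [Real.exp_sub, div_mul_eq_mul_div, le_div_iff₀ (Real.exp_pos _)]
  exact h5.trans hsum

lemma card_lower_tail_le (N : Finset Y) {l η : ℝ} (hl0 : 0 ≤ l) (hl : l ≤ 1) [Nonempty κ] :
    ((Finset.univ.filter fun w : κ → Y =>
        ((Finset.univ.filter fun y => w y ∈ N).card : ℝ) <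
          (N.card / Fintype.card Y - η) * Fintype.card κ).card : ℝ) ≤
      Real.exp (1 + l ^ 2 * Fintype.card κ - l * η * Fintype.card κ) *
        (Fintype.card Y : ℝ) ^ Fintype.card κ := by
  obtain ⟨x⟩ := ‹Nonempty κ›
  have hk : 0 < Fintype.card κ := Fintype.card_pos_iff.2 ⟨x⟩
  rw [Finset.card_eq_sum_card_fiberwise (f := fun w => w x) (t := Finset.univ)
    (fun _ _ => Finset.mem_coe.2 (Finset.mem_univ _))]
  push_cast
  calc _ ≤ ∑ v : Y, Real.exp (1 + l ^ 2 * Fintype.card κ - l * η * Fintype.card κ) *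
        (Fintype.card Y : ℝ) ^ (Fintype.card κ - 1) := by
        refine Finset.sum_le_sum fun v _ => ?_
        rw [Finset.filter_filter]
        simp_rw [and_comm (b := _ = v)]
        exact card_lower_tail_fixed_le N hl0 hl x v
    _ = _ := by
      rw [Finset.sum_const, Finset.card_univ, nsmul_eq_mul, mul_left_comm, ← pow_succ',
        Nat.sub_add_cancel hk]

end Tail

section SumUnion

variable {ι τ : Type*} [DecidableEq ι] {p : ι → ℝ}

lemma sum_union_le_of_nonneg (hp : ∀ i, 0 ≤ p i) (S T : Finset ι) :
    ∑ i ∈ S ∪ T, p i ≤ ∑ i ∈ S, p i + ∑ i ∈ T, p i := by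
  rw [← Finset.sum_union_inter]
  exact le_add_of_nonneg_right (Finset.sum_nonneg fun i _ => hp i)

lemma sum_biUnion_le_of_nonneg (hp : ∀ i, 0 ≤ p i) (R : Finset τ) (Γ : τ → Finset ι) :
    ∑ i ∈ R.biUnion Γ, p i ≤ ∑ t ∈ R, ∑ i ∈ Γ t, p i := by
  classical
  induction R using Finset.induction_on with
  | empty => simp
  | insert t R ht ih =>
    rw [Finset.biUnion_insert, Finset.sum_insert ht]
    exact (sum_union_le_of_nonneg hp _ _).trans (by gcongr)

end SumUnion

section Clusters

open Classical in
/-- The neighbours of `v` in the bipartite graph `Adj`, where `v` is a vertex of the first part if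
`b = true` and of the second part otherwise. -/
noncomputable def neighbors {Y : Type*} [Fintype Y] (Adj : Y → Y → Prop) (b : Bool) (v : Y) :
    Finset Y :=
  Finset.univ.filter fun u => (b = true ∧ Adj v u) ∨ (b = false ∧ Adj u v)

/-- A cluster, listed as two families of vertices indexed by `κ`, is bad if one of its vertices has
relative degree inside the cluster smaller by more than `η` than in the whole graph. -/
def IsBad {κ Y : Type*} [Fintype κ] [Fintype Y] [DecidableEq Y] (Adj : Y → Y → Prop) (η : ℝ)
    (w : Bool → κ → Y) : Prop :=
  ∃ q : Bool × κ, ((Finset.univ.filter fun y => w (!q.1) y ∈ neighbors Adj q.1 (w q.1 q.2)).card : ℝ)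
    < ((neighbors Adj q.1 (w q.1 q.2)).card / Fintype.card Y - η) * Fintype.card κ

section Counting

variable {κ Y : Type*} [Fintype κ] [DecidableEq κ] [Fintype Y] [DecidableEq Y]

lemma card_filter_apply_eq (x : κ) (v : Y) :
    (Finset.univ.filter fun u : κ → Y => u x = v).card =
      Fintype.card Y ^ (Fintype.card κ - 1) := by
  have h : (Finset.univ.filter fun u : κ → Y => u x = v) =
      Fintype.piFinset fun y => if y = x then {v} else Finset.univ := by
    ext u
    simp only [Finset.mem_filter, Finset.mem_univ, true_and, Fintype.mem_piFinset]
    refine ⟨fun hu y => ?_, fun hu => by simpa using hu x⟩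
    split_ifs with hy
    · rw [hy, Finset.mem_singleton, hu]
    · exact Finset.mem_univ _
  rw [h, Fintype.card_piFinset, ← Finset.mul_prod_erase _ _ (Finset.mem_univ x)]
  simp only [if_true, Finset.card_singleton, one_mul]
  rw [Finset.prod_congr rfl (g := fun _ => Fintype.card Y)
    (fun y hy => by rw [if_neg (Finset.ne_of_mem_erase hy), Finset.card_univ]),
    Finset.prod_const, Finset.card_erase_of_mem (Finset.mem_univ x), Finset.card_univ]

lemma card_filter_bool_le {κ Y : Type*} [Fintype κ] [DecidableEq κ] [Fintype Y] (b : Bool)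
    (P : (κ → Y) → Prop) (Q : (κ → Y) → (κ → Y) → Prop)
    [DecidablePred P] [∀ u, DecidablePred (Q u)] {c : ℝ}
    (hQ : ∀ u, ((Finset.univ.filter (Q u)).card : ℝ) ≤ c) :
    ((Finset.univ.filter fun w : Bool → κ → Y => P (w b) ∧ Q (w b) (w (!b))).card : ℝ) ≤
      (Finset.univ.filter P).card * c := by
  have h : (Finset.univ.filter fun w : Bool → κ → Y => P (w b) ∧ Q (w b) (w (!b))).card ≤
      ((Finset.univ.filter P).sigma fun u => Finset.univ.filter (Q u)).card := by
    refine Finset.card_le_card_of_injOn (fun w => ⟨w b, w (!b)⟩) ?_ ?_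
    · intro w hw
      simpa using hw
    · intro w _ w' _ h
      simp only [Sigma.mk.injEq, heq_eq_eq] at h
      funext c
      cases b <;> cases c <;> simp_all
  rw [Finset.card_sigma] at h
  calc _ ≤ ((∑ u ∈ Finset.univ.filter P, (Finset.univ.filter (Q u)).card : ℕ) : ℝ) := by
        exact_mod_cast h
    _ ≤ ∑ u ∈ Finset.univ.filter P, c := by
      push_cast
      exact Finset.sum_le_sum fun u _ => hQ u
    _ = _ := by rw [Finset.sum_const, nsmul_eq_mul]

open Classical in
lemma card_isBad_fixed_le (Adj : Y → Y → Prop) {l : ℝ} (hl0 : 0 ≤ l) (hl : l ≤ 1)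
    (b₀ : Bool) (x₀ : κ) (v : Y) :
    ((Finset.univ.filter fun w : Bool → κ → Y => IsBad Adj (2 * l) w ∧ w b₀ x₀ = v).card : ℝ) ≤
      2 * Fintype.card κ * Real.exp (1 - l ^ 2 * Fintype.card κ) *
        (Fintype.card Y : ℝ) ^ (2 * Fintype.card κ - 1) := by
  set k := Fintype.card κ with hk
  set n := Fintype.card Y with hn
  have hk0 : 0 < k := Fintype.card_pos_iff.2 ⟨x₀⟩
  have hne : Nonempty κ := ⟨x₀⟩
  have hexp : Real.exp (1 + l ^ 2 * k - l * (2 * l) * k) = Real.exp (1 - l ^ 2 * k) := by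
    congr 1
    ring
  have hpow : (n : ℝ) ^ (k - 1) * (n : ℝ) ^ k = (n : ℝ) ^ (2 * k - 1) := by
    rw [← pow_add]
    congr 1
    omega
  let Q : Bool × κ → (κ → Y) → (κ → Y) → Prop := fun q u u' =>
    ((Finset.univ.filter fun y => u' y ∈ neighbors Adj q.1 (u q.2)).card : ℝ)
      < ((neighbors Adj q.1 (u q.2)).card / n - 2 * l) * k
  have hone : ∀ q : Bool × κ, ((Finset.univ.filter fun w : Bool → κ → Y =>
      w b₀ x₀ = v ∧ Q q (w q.1) (w (!q.1))).card : ℝ) ≤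
        Real.exp (1 - l ^ 2 * k) * (n : ℝ) ^ (2 * k - 1) := by
    rintro ⟨b, x⟩
    by_cases hb : b = b₀
    · subst hb
      refine (card_filter_bool_le b (fun u => u x₀ = v) (Q (b, x))
        (fun u => card_lower_tail_le (η := 2 * l) _ hl0 hl)).trans (le_of_eq ?_)
      rw [card_filter_apply_eq, hexp, ← hpow]
      push_cast
      ring
    · have hb' : b₀ = !b := by cases b <;> cases b₀ <;> simp_all
      subst hb'
      have := (card_filter_bool_le b (fun _ => True) (fun u u' => u' x₀ = v ∧ Q (b, x) u u')
        (fun u => card_lower_tail_fixed_le (η := 2 * l) _ hl0 hl x₀ v))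
      simp only [true_and, Finset.filter_true, Finset.card_univ, Fintype.card_pi,
        Finset.prod_const, ← hk, ← hn] at this
      refine this.trans (le_of_eq ?_)
      rw [hexp, ← hpow]
      push_cast
      ring
  have hsub : (Finset.univ.filter fun w : Bool → κ → Y => IsBad Adj (2 * l) w ∧ w b₀ x₀ = v) ⊆
      Finset.univ.biUnion fun q : Bool × κ => Finset.univ.filter fun w : Bool → κ → Y =>
        w b₀ x₀ = v ∧ Q q (w q.1) (w (!q.1)) := by
    intro w hw
    obtain ⟨⟨q, hq⟩, hv⟩ := (Finset.mem_filter.1 hw).2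
    exact Finset.mem_biUnion.2 ⟨q, Finset.mem_univ _, Finset.mem_filter.2
      ⟨Finset.mem_univ _, hv, hq⟩⟩
  calc _ ≤ ((∑ q : Bool × κ, (Finset.univ.filter fun w : Bool → κ → Y =>
          w b₀ x₀ = v ∧ Q q (w q.1) (w (!q.1))).card : ℕ) : ℝ) := by
        exact_mod_cast (Finset.card_le_card hsub).trans Finset.card_biUnion_le
    _ ≤ ∑ q : Bool × κ, Real.exp (1 - l ^ 2 * k) * (n : ℝ) ^ (2 * k - 1) := by
      push_cast
      exact Finset.sum_le_sum fun q _ => hone q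
    _ = _ := by
      rw [Finset.sum_const, Finset.card_univ, Fintype.card_prod, Fintype.card_bool, nsmul_eq_mul]
      push_cast
      ring

open Classical in
lemma card_isBad_le (Adj : Y → Y → Prop) {l : ℝ} (hl0 : 0 ≤ l) (hl : l ≤ 1) [Nonempty κ] :
    ((Finset.univ.filter fun w : Bool → κ → Y => IsBad Adj (2 * l) w).card : ℝ) ≤
      2 * Fintype.card κ * Real.exp (1 - l ^ 2 * Fintype.card κ) *
        (Fintype.card Y : ℝ) ^ (2 * Fintype.card κ) := by
  obtain ⟨x⟩ := ‹Nonempty κ›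
  have hk : 0 < Fintype.card κ := Fintype.card_pos_iff.2 ⟨x⟩
  rw [Finset.card_eq_sum_card_fiberwise (f := fun w => w true x) (t := Finset.univ)
    (fun _ _ => Finset.mem_coe.2 (Finset.mem_univ _))]
  push_cast
  calc _ ≤ ∑ v : Y, 2 * Fintype.card κ * Real.exp (1 - l ^ 2 * Fintype.card κ) *
        (Fintype.card Y : ℝ) ^ (2 * Fintype.card κ - 1) := by
        refine Finset.sum_le_sum fun v _ => ?_
        rw [Finset.filter_filter]
        exact card_isBad_fixed_le Adj hl0 hl true x v
    _ = _ := by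
      rw [Finset.sum_const, Finset.card_univ, nsmul_eq_mul, mul_left_comm, ← pow_succ',
        Nat.sub_add_cancel (by omega)]

end Counting

variable {m : ℕ} {k : Fin m → ℕ} {Y : Type*} [Fintype Y] [DecidableEq Y]

/-- The atoms prescribing that the cluster `j.1` consists of the vertices listed by `j.2`. -/
def clusterAtoms (j : Σ i, Bool → Fin (k i) → Y) :
    Finset (Bool × (Σ i, Fin (k i)) × Y) :=
  Finset.univ.image fun q : Bool × Fin (k j.1) => (q.1, ⟨j.1, q.2⟩, j.2 q.1 q.2)

lemma mem_clusterAtoms {Y : Type*} [DecidableEq Y] {j : Σ i, Bool → Fin (k i) → Y}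
    {e : Bool × (Σ i, Fin (k i)) × Y} :
    e ∈ clusterAtoms j ↔ ∃ b x, (b, ⟨j.1, x⟩, j.2 b x) = e := by
  simp [clusterAtoms]

lemma card_filter_clusterAtoms {Y : Type*} [DecidableEq Y]
    (j : Σ i, Bool → Fin (k i) → Y) (b : Bool) :
    ((clusterAtoms j).filter fun a => a.1 = b).card = k j.1 := by
  have h : ((clusterAtoms j).filter fun a => a.1 = b) =
      Finset.univ.image fun x : Fin (k j.1) =>
        ((b, ⟨j.1, x⟩, j.2 b x) : Bool × (Σ i, Fin (k i)) × Y) := by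
    ext e
    simp only [Finset.mem_filter, mem_clusterAtoms, Finset.mem_image, Finset.mem_univ, true_and]
    constructor
    · rintro ⟨⟨b', x, rfl⟩, rfl⟩
      exact ⟨x, rfl⟩
    · rintro ⟨x, rfl⟩
      exact ⟨⟨b, x, rfl⟩, rfl⟩
  rw [h, Finset.card_image_of_injective, Finset.card_univ, Fintype.card_fin]
  intro x x' hx
  simp only [Prod.mk.injEq, Sigma.mk.injEq, heq_eq_eq, true_and] at hx
  exact hx.1

open Classical in
/-- The bad contents of clusters. -/
noncomputable def badContents (k : Fin m → ℕ) (Adj : Y → Y → Prop) (η : ℝ) :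
    Finset (Σ i, Bool → Fin (k i) → Y) :=
  Finset.univ.filter fun j => IsBad Adj η j.2

lemma mem_badContents {Adj : Y → Y → Prop} {η : ℝ} {j : Σ i, Bool → Fin (k i) → Y} :
    j ∈ badContents k Adj η ↔ IsBad Adj η j.2 := by
  simp [badContents]

/-- An upper bound for the probability that a cluster has a given content. -/
noncomputable def contentWeight (j : Σ i, Bool → Fin (k i) → Y) : ℝ :=
  4 / (Fintype.card Y : ℝ) ^ (2 * k j.1)

lemma contentWeight_nonneg {Y : Type*} [Fintype Y] (j : Σ i, Bool → Fin (k i) → Y) : 0 ≤ contentWeight j := by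
  unfold contentWeight
  positivity

/-- The tuples of bijections none of whose clusters is bad. -/
noncomputable def goodTuples (k : Fin m → ℕ) (Adj : Y → Y → Prop) (η : ℝ) :
    Finset (Bool → (Σ i, Fin (k i)) ≃ Y) :=
  avoiding (fun j => extending (clusterAtoms j)) (badContents k Adj η)

lemma not_isBad_of_mem_goodTuples {Adj : Y → Y → Prop} {η : ℝ} {ω : Bool → (Σ i, Fin (k i)) ≃ Y}
    (hω : ω ∈ goodTuples k Adj η) (i : Fin m) :
    ¬ IsBad Adj η fun b (x : Fin (k i)) => ω b ⟨i, x⟩ := by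
  intro hbad
  refine mem_avoiding.1 hω ⟨i, fun b x => ω b ⟨i, x⟩⟩ (mem_badContents.2 hbad)
    (mem_extending.2 fun e he => ?_)
  obtain ⟨b, x, rfl⟩ := mem_clusterAtoms.1 he
  rfl

section Sums

variable {Adj : Y → Y → Prop} {l δ : ℝ}

open Classical in
lemma sum_contentWeight_cluster_le (hl0 : 0 ≤ l) (hl : l ≤ 1) (hk : ∀ i, 0 < k i)
    (hδ : ∀ i, 8 * k i * Real.exp (1 - l ^ 2 * k i) ≤ δ) (hY : 0 < Fintype.card Y) (i : Fin m) :
    ∑ j ∈ (badContents k Adj (2 * l)).filter (fun j => j.1 = i), contentWeight j ≤ δ := by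
  have h1 : (badContents k Adj (2 * l)).filter (fun j => j.1 = i) =
      ({i} : Finset (Fin m)).sigma fun i =>
        Finset.univ.filter fun w : Bool → Fin (k i) → Y => IsBad Adj (2 * l) w := by
    ext ⟨i', w⟩
    simp [mem_badContents, and_comm]
  have hn : (0 : ℝ) < (Fintype.card Y : ℝ) ^ (2 * k i) := by positivity
  have : Nonempty (Fin (k i)) := ⟨⟨0, hk i⟩⟩
  rw [h1, Finset.sum_sigma, Finset.sum_singleton]
  simp only [contentWeight, Finset.sum_const, nsmul_eq_mul]
  have h2 := card_isBad_le (κ := Fin (k i)) Adj hl0 hl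
  rw [Fintype.card_fin] at h2
  refine le_trans ?_ (hδ i)
  rw [mul_div_assoc', div_le_iff₀ hn]
  linarith

open Classical in
lemma sum_contentWeight_vertex_le (hl0 : 0 ≤ l) (hl : l ≤ 1) (hk : ∀ i, 0 < k i)
    (hδ : ∀ i, 8 * k i * Real.exp (1 - l ^ 2 * k i) ≤ δ) (hY : 0 < Fintype.card Y)
    (hsum : ∑ i, k i = Fintype.card Y) (b : Bool) (v : Y) :
    ∑ j ∈ (badContents k Adj (2 * l)).filter (fun j => ∃ x, j.2 b x = v), contentWeight j ≤ δ := by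
  have h1 : (badContents k Adj (2 * l)).filter (fun j => ∃ x, j.2 b x = v) =
      (Finset.univ : Finset (Fin m)).sigma fun i =>
        Finset.univ.biUnion fun x : Fin (k i) =>
          Finset.univ.filter fun w : Bool → Fin (k i) → Y => IsBad Adj (2 * l) w ∧ w b x = v := by
    ext ⟨i', w⟩
    simp [mem_badContents]
  have hn : (0 : ℝ) < Fintype.card Y := by exact_mod_cast hY
  rw [h1, Finset.sum_sigma]
  simp only [contentWeight, Finset.sum_const, nsmul_eq_mul]
  have h3 : ∀ i, ((Finset.univ.biUnion fun x : Fin (k i) => Finset.univ.filter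
      fun w : Bool → Fin (k i) → Y => IsBad Adj (2 * l) w ∧ w b x = v).card : ℝ) *
        (4 / (Fintype.card Y : ℝ) ^ (2 * k i)) ≤ k i * (δ / Fintype.card Y) := by
    intro i
    have h4 : ((Finset.univ.biUnion fun x : Fin (k i) => Finset.univ.filter
        fun w : Bool → Fin (k i) → Y => IsBad Adj (2 * l) w ∧ w b x = v).card : ℝ) ≤
        k i * (2 * k i * Real.exp (1 - l ^ 2 * k i) *
        (Fintype.card Y : ℝ) ^ (2 * k i - 1)) := by
      calc _ ≤ ((∑ x : Fin (k i), (Finset.univ.filter fun w : Bool → Fin (k i) → Y =>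
            IsBad Adj (2 * l) w ∧ w b x = v).card : ℕ) : ℝ) := by
            exact_mod_cast Finset.card_biUnion_le
        _ ≤ ∑ x : Fin (k i), 2 * k i * Real.exp (1 - l ^ 2 * k i) *
            (Fintype.card Y : ℝ) ^ (2 * k i - 1) := by
          push_cast
          refine Finset.sum_le_sum fun x _ => ?_
          have h2 := card_isBad_fixed_le (κ := Fin (k i)) Adj hl0 hl b x v
          rwa [Fintype.card_fin] at h2
        _ = _ := by rw [Finset.sum_const, Finset.card_univ, Fintype.card_fin, nsmul_eq_mul]
    have h5 : (Fintype.card Y : ℝ) ^ (2 * k i) =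
        (Fintype.card Y : ℝ) ^ (2 * k i - 1) * Fintype.card Y := by
      rw [← pow_succ, Nat.sub_add_cancel (by have := hk i; omega)]
    have h6 : (0 : ℝ) < (Fintype.card Y : ℝ) ^ (2 * k i - 1) := by positivity
    calc _ ≤ k i * (2 * k i * Real.exp (1 - l ^ 2 * k i) *
          (Fintype.card Y : ℝ) ^ (2 * k i - 1)) * (4 / (Fintype.card Y : ℝ) ^ (2 * k i)) := by
          gcongr
      _ = k i * (8 * k i * Real.exp (1 - l ^ 2 * k i) / Fintype.card Y) := by
        rw [h5]
        field_simp
        ring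
      _ ≤ _ := by
        gcongr
        exact hδ i
  calc _ ≤ ∑ i, (k i : ℝ) * (δ / Fintype.card Y) := Finset.sum_le_sum fun i _ => h3 i
    _ = _ := by
      rw [← Finset.sum_mul, ← Nat.cast_sum, hsum]
      field_simp

open Classical in
lemma sum_contentWeight_dependent_le (hl0 : 0 ≤ l) (hl : l ≤ 1) (hk : ∀ i, 0 < k i)
    (hδ : ∀ i, 8 * k i * Real.exp (1 - l ^ 2 * k i) ≤ δ) (hY : 0 < Fintype.card Y)
    (hsum : ∑ i, k i = Fintype.card Y) (j : Σ i, Bool → Fin (k i) → Y) :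
    ∑ j' ∈ (badContents k Adj (2 * l)).filter
        (fun j' => ¬ Independent (clusterAtoms j) (clusterAtoms j')), contentWeight j' ≤
      (1 + 2 * k j.1) * δ := by
  have hsub : (badContents k Adj (2 * l)).filter
      (fun j' => ¬ Independent (clusterAtoms j) (clusterAtoms j')) ⊆
      (badContents k Adj (2 * l)).filter (fun j' => j'.1 = j.1) ∪
        Finset.univ.biUnion fun q : Bool × Fin (k j.1) =>
          (badContents k Adj (2 * l)).filter (fun j' => ∃ x, j'.2 q.1 x = j.2 q.1 q.2) := by
    intro j' hj'
    obtain ⟨hbad, hdep⟩ := Finset.mem_filter.1 hj'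
    by_contra hcon
    simp only [Finset.mem_union, Finset.mem_filter, Finset.mem_biUnion, Finset.mem_univ, true_and,
      hbad, not_or, not_exists, Prod.forall] at hcon
    refine hdep fun e he f hf hef => ?_
    obtain ⟨b, x, rfl⟩ := mem_clusterAtoms.1 he
    obtain ⟨b', x', rfl⟩ := mem_clusterAtoms.1 hf
    simp only at hef
    subst hef
    exact ⟨fun h => hcon.1 (congrArg Sigma.fst h).symm, fun h => hcon.2 b x x' h.symm⟩
  have hnn := contentWeight_nonneg (k := k) (Y := Y)
  calc _ ≤ _ := Finset.sum_le_sum_of_subset_of_nonneg hsub fun j _ _ => hnn j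
    _ ≤ _ + ∑ q : Bool × Fin (k j.1), _ := (sum_union_le_of_nonneg hnn _ _).trans
      (add_le_add_right (sum_biUnion_le_of_nonneg hnn _ _) _)
    _ ≤ δ + ∑ q : Bool × Fin (k j.1), δ :=
      add_le_add (sum_contentWeight_cluster_le hl0 hl hk hδ hY j.1)
        (Finset.sum_le_sum fun q _ => sum_contentWeight_vertex_le hl0 hl hk hδ hY hsum _ _)
    _ = _ := by
      rw [Finset.sum_const, Finset.card_univ, Fintype.card_prod, Fintype.card_bool,
        Fintype.card_fin, nsmul_eq_mul]
      push_cast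
      ring

end Sums

end Clusters

section GoodTuples

variable {m : ℕ} {k : Fin m → ℕ} {Y : Type*} [Fintype Y] [DecidableEq Y] {Adj : Y → Y → Prop}
  {l δ : ℝ} {K : ℕ}

lemma card_extending_clusterAtoms_le {S : Finset (Σ i, Bool → Fin (k i) → Y)}
    (j : Σ i, Bool → Fin (k i) → Y) (hn : 2 * k j.1 ^ 2 ≤ Fintype.card Y)
    (hY : 0 < Fintype.card Y)
    (hS : ∀ j' ∈ S, Independent (clusterAtoms j) (clusterAtoms j')) :
    ((extending (clusterAtoms j) ∩
        avoiding (fun j => extending (clusterAtoms j)) S).card : ℝ) ≤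
      contentWeight j * (avoiding (fun j => extending (clusterAtoms j)) S).card := by
  have h1 := card_extending_mul_prod_descFactorial_le (clusterAtoms j) hS
  simp only [card_filter_clusterAtoms, Finset.prod_const, Finset.card_univ,
    Fintype.card_bool] at h1
  have h2 := pow_le_two_mul_descFactorial hn
  have hpos : (0 : ℝ) < (Fintype.card Y : ℝ) ^ (2 * k j.1) := by positivity
  have h3 : (Fintype.card Y : ℝ) ^ (2 * k j.1) ≤
      4 * ((Fintype.card Y).descFactorial (k j.1) : ℝ) ^ 2 := by
    rw [mul_comm 2, pow_mul]
    calc _ ≤ (2 * ((Fintype.card Y).descFactorial (k j.1) : ℝ)) ^ 2 := by gcongr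
      _ = _ := by ring
  rw [contentWeight, div_mul_eq_mul_div, le_div_iff₀ hpos]
  refine (mul_le_mul_of_nonneg_left h3 (Nat.cast_nonneg _)).trans ?_
  rw [mul_left_comm]
  gcongr
  exact_mod_cast h1

/-- The hypotheses under which the local lemma applies to the bad events. -/
structure LocalLemmaBounds (k : Fin m → ℕ) (Y : Type*) [Fintype Y] (l δ : ℝ) (K : ℕ) : Prop where
  nonneg : 0 ≤ l
  le_one : l ≤ 1
  pos : ∀ i, 0 < k i
  le : ∀ i, k i ≤ K
  sum_eq : ∑ i, k i = Fintype.card Y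
  card_pos : 0 < Fintype.card Y
  large : 2 * K ^ 2 ≤ Fintype.card Y
  delta_nonneg : 0 ≤ δ
  tail : ∀ i, 8 * k i * Real.exp (1 - l ^ 2 * k i) ≤ δ
  delta : (1 + 2 * K) * δ ≤ 1 / 4

lemma LocalLemmaBounds.delta_le {Y : Type*} [Fintype Y] (H : LocalLemmaBounds k Y l δ K) : δ ≤ 1 / 4 := by
  have h1 := H.delta
  have h2 : 0 ≤ (K : ℝ) * δ := mul_nonneg (Nat.cast_nonneg _) H.delta_nonneg
  linarith

lemma LocalLemmaBounds.card_extending_inter_le (H : LocalLemmaBounds k Y l δ K)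
    (S : Finset (Σ i, Bool → Fin (k i) → Y)) (hS : S ⊆ badContents k Adj (2 * l)) :
    ∀ j ∈ badContents k Adj (2 * l),
      ((extending (clusterAtoms j) ∩
          avoiding (fun j => extending (clusterAtoms j)) S).card : ℝ) ≤
        2 * contentWeight j * (avoiding (fun j => extending (clusterAtoms j)) S).card := by
  classical
  refine lopsided_local_lemma
    (r := fun j j' => ¬ Independent (clusterAtoms j) (clusterAtoms j')) ?_
    contentWeight_nonneg ?_ S hS
  · intro j _ S _ hj
    refine card_extending_clusterAtoms_le j (le_trans ?_ H.large) H.card_pos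
      fun j' hj' => not_not.1 (hj j' hj')
    have := H.le j.1
    gcongr
  · intro j _
    refine (sum_contentWeight_dependent_le H.nonneg H.le_one H.pos H.tail H.card_pos
      H.sum_eq j).trans (le_trans ?_ H.delta)
    have := H.le j.1
    have := H.delta_nonneg
    gcongr

lemma LocalLemmaBounds.card_goodTuples_pos (H : LocalLemmaBounds k Y l δ K) :
    0 < (goodTuples k Adj (2 * l)).card := by
  classical
  have h1 := card_avoiding_le_two_pow_mul (S := ∅)
    (fun S hS => H.card_extending_inter_le (Adj := Adj) S hS) (Finset.empty_subset _)
    Finset.univ (fun i => (badContents k Adj (2 * l)).filter fun j => j.1 = i)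
    (fun _ _ => Finset.filter_subset _ _)
    (fun i _ => (sum_contentWeight_cluster_le H.nonneg H.le_one H.pos H.tail H.card_pos i).trans
      H.delta_le)
  have h2 : ∅ ∪ (Finset.univ.biUnion fun i => (badContents k Adj (2 * l)).filter
      fun j => j.1 = i) = badContents k Adj (2 * l) := by
    ext j
    simp
  rw [h2] at h1
  have h3 : Nonempty (Bool → (Σ i, Fin (k i)) ≃ Y) := by
    have : Fintype.card (Σ i, Fin (k i)) = Fintype.card Y := by simp [H.sum_eq]
    exact ⟨fun _ => Fintype.equivOfCardEq this⟩
  have h4 : 0 < (avoiding (fun j : Σ i, Bool → Fin (k i) → Y =>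
      extending (clusterAtoms j)) ∅).card := by
    rw [Finset.card_pos, avoiding, Finset.biUnion_empty, Finset.sdiff_empty]
    exact Finset.univ_nonempty
  have h5 : (0 : ℝ) < (avoiding (fun j : Σ i, Bool → Fin (k i) → Y =>
      extending (clusterAtoms j)) ∅).card := by exact_mod_cast h4
  by_contra hcon
  rw [goodTuples, not_lt, Nat.le_zero] at hcon
  rw [hcon] at h1
  simp only [Nat.cast_zero, mul_zero] at h1
  linarith

lemma prod_descFactorial_ge {X Y : Type*} [Fintype Y] (E : Finset (Bool × X × Y))
    (hE : Set.InjOn (fun e : Bool × X × Y => (e.1, e.2.2)) E) :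
    (Fintype.card Y : ℝ) ^ E.card ≤ Real.exp 1 ^ E.card *
      ∏ b, ((Fintype.card Y).descFactorial (E.filter fun a => a.1 = b).card : ℝ) := by
  have h1 : E.card = ∑ b, (E.filter fun a => a.1 = b).card :=
    Finset.card_eq_sum_card_fiberwise fun _ _ => Finset.mem_coe.2 (Finset.mem_univ _)
  rw [h1, ← Finset.prod_pow_eq_pow_sum, ← Finset.prod_pow_eq_pow_sum, ← Finset.prod_mul_distrib]
  refine Finset.prod_le_prod (fun _ _ => by positivity) fun b _ =>
    pow_le_exp_mul_descFactorial _ _ ?_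
  rw [← Finset.card_univ]
  refine Finset.card_le_card_of_injOn (fun e => e.2.2) (fun _ _ => Finset.mem_coe.2
    (Finset.mem_univ _)) fun e he e' he' h => ?_
  rw [Finset.mem_coe, Finset.mem_filter] at he he'
  exact hE he.1 he'.1 (Prod.ext (he.2.trans he'.2.symm) h)

/-- A uniformly random good tuple places prescribed vertices at prescribed positions with
probability at most `(4 * e / n) ^ s`. -/
lemma LocalLemmaBounds.card_extending_inter_goodTuples_le (H : LocalLemmaBounds k Y l δ K)
    {s : ℕ} (side : Fin s → Bool) (val : Fin s → Y)
    (hinj : Function.Injective fun t => (side t, val t)) (pos : Fin s → Σ i, Fin (k i)) :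
    ((extending (Finset.univ.image fun t => (side t, pos t, val t)) ∩
        goodTuples k Adj (2 * l)).card : ℝ) * (Fintype.card Y : ℝ) ^ s ≤
      (4 * Real.exp 1) ^ s * (goodTuples k Adj (2 * l)).card := by
  classical
  set E := Finset.univ.image fun t => (side t, pos t, val t) with hE
  have hEcard : E.card = s := by
    rw [hE, Finset.card_image_of_injective, Finset.card_univ, Fintype.card_fin]
    intro t t' h
    simp only [Prod.mk.injEq] at h
    exact hinj (Prod.ext h.1 h.2.2)
  have hEinj : Set.InjOn (fun e : Bool × (Σ i, Fin (k i)) × Y => (e.1, e.2.2)) E := by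
    intro e he e' he' h
    obtain ⟨t, -, rfl⟩ := Finset.mem_image.1 (Finset.mem_coe.1 he)
    obtain ⟨t', -, rfl⟩ := Finset.mem_image.1 (Finset.mem_coe.1 he')
    rw [hinj h]
  set I := badContents k Adj (2 * l) with hI
  set S := I.filter fun j => Independent E (clusterAtoms j) with hS
  have hSI : S ⊆ I := Finset.filter_subset _ _
  let Γ : Fin s × Bool → Finset (Σ i, Bool → Fin (k i) → Y) := fun q =>
    if q.2 then I.filter fun j => j.1 = (pos q.1).1
    else I.filter fun j => ∃ x, j.2 (side q.1) x = val q.1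
  have hΓ : ∀ q, Γ q ⊆ I := by
    intro q
    simp only [Γ]
    split_ifs <;> exact Finset.filter_subset _ _
  have hΓsum : ∀ q, ∑ j ∈ Γ q, contentWeight j ≤ 1 / 4 := by
    intro q
    refine le_trans ?_ H.delta_le
    simp only [Γ]
    split_ifs
    · exact sum_contentWeight_cluster_le H.nonneg H.le_one H.pos H.tail H.card_pos _
    · exact sum_contentWeight_vertex_le H.nonneg H.le_one H.pos H.tail H.card_pos H.sum_eq _ _
  have h1 := card_avoiding_le_two_pow_mul
    (fun S hS => H.card_extending_inter_le (Adj := Adj) S hS) hSI Finset.univ Γ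
    (fun q _ => hΓ q) (fun q _ => hΓsum q)
  have hcover : S ∪ Finset.univ.biUnion Γ = I := by
    refine Finset.Subset.antisymm (Finset.union_subset hSI
      (Finset.biUnion_subset.2 fun q _ => hΓ q)) fun j hj => ?_
    by_contra hcon
    simp only [Finset.mem_union, Finset.mem_biUnion, Finset.mem_univ, true_and, not_or,
      not_exists] at hcon
    refine hcon.1 (Finset.mem_filter.2 ⟨hj, fun e he f hf hef => ?_⟩)
    obtain ⟨t, -, rfl⟩ := Finset.mem_image.1 he
    obtain ⟨b, x, rfl⟩ := mem_clusterAtoms.1 hf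
    simp only at hef
    subst hef
    constructor
    · intro h
      refine hcon.2 (t, true) ?_
      simp only [Γ, if_true]
      exact Finset.mem_filter.2 ⟨hj, (congrArg Sigma.fst h).symm⟩
    · intro h
      refine hcon.2 (t, false) ?_
      simp only [Γ, Bool.false_eq_true, if_false]
      exact Finset.mem_filter.2 ⟨hj, x, h.symm⟩
  rw [hcover] at h1
  have h2 : ((extending E ∩ avoiding (fun j => extending (clusterAtoms j)) S).card : ℝ) *
      ∏ b, ((Fintype.card Y).descFactorial (E.filter fun a => a.1 = b).card : ℝ) ≤
        (avoiding (fun j => extending (clusterAtoms j)) S).card := by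
    exact_mod_cast card_extending_mul_prod_descFactorial_le E
      fun j hj => (Finset.mem_filter.1 hj).2
  have h3 := prod_descFactorial_ge E hEinj
  rw [hEcard] at h3
  have h4 : ((extending E ∩ goodTuples k Adj (2 * l)).card : ℝ) ≤
      (extending E ∩ avoiding (fun j => extending (clusterAtoms j)) S).card := by
    exact_mod_cast Finset.card_le_card (Finset.inter_subset_inter_left (avoiding_anti hSI))
  have h5 : (2 : ℝ) ^ (Finset.univ : Finset (Fin s × Bool)).card = 4 ^ s := by
    rw [Finset.card_univ, Fintype.card_prod, Fintype.card_fin, Fintype.card_bool, mul_comm,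
      pow_mul]
    norm_num
  rw [h5] at h1
  calc _ ≤ ((extending E ∩ avoiding (fun j => extending (clusterAtoms j)) S).card : ℝ) *
        (Real.exp 1 ^ s *
          ∏ b, ((Fintype.card Y).descFactorial (E.filter fun a => a.1 = b).card : ℝ)) := by
        gcongr
    _ = Real.exp 1 ^ s * (((extending E ∩
          avoiding (fun j => extending (clusterAtoms j)) S).card : ℝ) *
          ∏ b, ((Fintype.card Y).descFactorial (E.filter fun a => a.1 = b).card : ℝ)) := by ring
    _ ≤ Real.exp 1 ^ s * (4 ^ s * (goodTuples k Adj (2 * l)).card) := by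
        exact mul_le_mul_of_nonneg_left (h2.trans h1) (by positivity)
    _ = _ := by
        rw [mul_pow]
        ring

/-- A uniformly random good tuple places prescribed vertices into prescribed clusters with
probability at most `(4 * e * K / n) ^ s`. -/
lemma LocalLemmaBounds.card_goodTuples_filter_le (H : LocalLemmaBounds k Y l δ K)
    {s : ℕ} (side : Fin s → Bool) (val : Fin s → Y)
    (hinj : Function.Injective fun t => (side t, val t)) (f : Fin s → Fin m) :
    (((goodTuples k Adj (2 * l)).filter
        fun ω => ∀ t, ((ω (side t)).symm (val t)).1 = f t).card : ℝ) *
        (Fintype.card Y : ℝ) ^ s ≤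
      (4 * Real.exp 1 * K) ^ s * (goodTuples k Adj (2 * l)).card := by
  classical
  have hsub : (goodTuples k Adj (2 * l)).filter
        (fun ω => ∀ t, ((ω (side t)).symm (val t)).1 = f t) ⊆
      Finset.univ.biUnion fun c : ∀ t, Fin (k (f t)) =>
        extending (Finset.univ.image fun t => (side t, (⟨f t, c t⟩ : Σ i, Fin (k i)), val t)) ∩
          goodTuples k Adj (2 * l) := by
    intro ω hω
    obtain ⟨hgood, hf⟩ := Finset.mem_filter.1 hω
    have hex : ∀ t, ∃ x : Fin (k (f t)), ω (side t) ⟨f t, x⟩ = val t := by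
      intro t
      rw [← hf t]
      exact ⟨((ω (side t)).symm (val t)).2, by simp⟩
    choose c hc using hex
    refine Finset.mem_biUnion.2 ⟨c, Finset.mem_univ _, Finset.mem_inter.2
      ⟨mem_extending.2 fun e he => ?_, hgood⟩⟩
    obtain ⟨t, -, rfl⟩ := Finset.mem_image.1 he
    exact hc t
  have hcard : ((Finset.univ : Finset (∀ t, Fin (k (f t)))).card : ℝ) ≤ (K : ℝ) ^ s := by
    have : Fintype.card (∀ t, Fin (k (f t))) ≤ K ^ s := by
      rw [Fintype.card_pi]
      calc _ ≤ ∏ _t : Fin s, K := Finset.prod_le_prod' fun t _ => by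
            rw [Fintype.card_fin]
            exact H.le _
        _ = _ := by simp
    rw [Finset.card_univ]
    exact_mod_cast this
  calc _ ≤ (∑ c : ∀ t, Fin (k (f t)), ((extending (Finset.univ.image
          fun t => (side t, (⟨f t, c t⟩ : Σ i, Fin (k i)), val t)) ∩
          goodTuples k Adj (2 * l)).card : ℝ)) * (Fintype.card Y : ℝ) ^ s := by
        gcongr
        exact_mod_cast (Finset.card_le_card hsub).trans Finset.card_biUnion_le
    _ ≤ ∑ c : ∀ t, Fin (k (f t)), (4 * Real.exp 1) ^ s * ((goodTuples k Adj (2 * l)).card : ℝ) := by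
        rw [Finset.sum_mul]
        exact Finset.sum_le_sum fun c _ =>
          H.card_extending_inter_goodTuples_le side val hinj fun t => ⟨f t, c t⟩
    _ ≤ (K : ℝ) ^ s * ((4 * Real.exp 1) ^ s * ((goodTuples k Adj (2 * l)).card : ℝ)) := by
        rw [Finset.sum_const, nsmul_eq_mul]
        gcongr
    _ = _ := by
        rw [mul_pow _ (K : ℝ)]
        ring

end GoodTuples

section Partition

variable {m : ℕ} {k : Fin m → ℕ} {Y : Type*} [Fintype Y]

/-- The part of cluster `i` on side `b` determined by the bijections `ω`. -/
def clusterSide (ω : Bool → (Σ i, Fin (k i)) ≃ Y) (b : Bool) (i : Fin m) : Finset Y :=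
  Finset.univ.filter fun a => ((ω b).symm a).1 = i

lemma mem_clusterSide {ω : Bool → (Σ i, Fin (k i)) ≃ Y} {b : Bool} {i : Fin m} {a : Y} :
    a ∈ clusterSide ω b i ↔ ((ω b).symm a).1 = i := by
  simp [clusterSide]

lemma mem_clusterSide_iff_exists {ω : Bool → (Σ i, Fin (k i)) ≃ Y} {b : Bool} {i : Fin m} {a : Y} :
    a ∈ clusterSide ω b i ↔ ∃ x : Fin (k i), ω b ⟨i, x⟩ = a := by
  rw [mem_clusterSide]
  constructor
  · rintro rfl
    exact ⟨((ω b).symm a).2, by simp⟩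
  · rintro ⟨x, rfl⟩
    simp

lemma card_filter_clusterSide [DecidableEq Y] (ω : Bool → (Σ i, Fin (k i)) ≃ Y) (b : Bool) (i : Fin m)
    (P : Y → Prop) [DecidablePred P] :
    ((clusterSide ω b i).filter P).card =
      (Finset.univ.filter fun x : Fin (k i) => P (ω b ⟨i, x⟩)).card := by
  have h : (clusterSide ω b i).filter P =
      (Finset.univ.filter fun x : Fin (k i) => P (ω b ⟨i, x⟩)).image fun x => ω b ⟨i, x⟩ := by
    ext a
    simp only [Finset.mem_filter, mem_clusterSide_iff_exists, Finset.mem_image, Finset.mem_univ,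
      true_and]
    constructor
    · rintro ⟨⟨x, rfl⟩, hP⟩
      exact ⟨x, hP, rfl⟩
    · rintro ⟨x, hP, rfl⟩
      exact ⟨⟨x, rfl⟩, hP⟩
  rw [h, Finset.card_image_of_injective]
  intro x x' hx
  simpa using hx

lemma card_clusterSide [DecidableEq Y] (ω : Bool → (Σ i, Fin (k i)) ≃ Y) (b : Bool) (i : Fin m) :
    (clusterSide ω b i).card = k i := by
  have := card_filter_clusterSide ω b i fun _ => True
  simpa using this

lemma le_card_filter_clusterSide [DecidableEq Y] {Adj : Y → Y → Prop} {η : ℝ} {ω : Bool → (Σ i, Fin (k i)) ≃ Y}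
    (hω : ω ∈ goodTuples k Adj η) (b : Bool) (i : Fin m) {v : Y} (hv : v ∈ clusterSide ω b i) :
    ((neighbors Adj b v).card / Fintype.card Y - η) * k i ≤
      (((clusterSide ω (!b) i).filter fun u => u ∈ neighbors Adj b v).card : ℝ) := by
  obtain ⟨x, rfl⟩ := mem_clusterSide_iff_exists.1 hv
  have h := not_isBad_of_mem_goodTuples hω i
  simp only [IsBad, not_exists, not_lt, Fintype.card_fin] at h
  rw [card_filter_clusterSide]
  exact h (b, x)

end Partition

open Classical in
/-- The distribution of the random variable `g` on the finite sample space `Ω` with the uniform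
measure. -/
noncomputable def uniformLaw {Ω A : Type*} (S : Finset Ω) (g : Ω → A) (x : A) : ℝ :=
  (S.filter fun ω => g ω = x).card / S.card

section UniformLaw

variable {Ω A : Type*} {S : Finset Ω} {g : Ω → A}

lemma uniformLaw_nonneg (x : A) : 0 ≤ uniformLaw S g x := by
  unfold uniformLaw
  positivity

lemma exists_of_uniformLaw_ne_zero {x : A} (h : uniformLaw S g x ≠ 0) : ∃ ω ∈ S, g ω = x := by
  classical
  by_contra! hcon
  refine h ?_
  rw [uniformLaw, Finset.filter_false_of_mem hcon]
  simp

lemma sum_filter_uniformLaw [Fintype A] (Q : A → Prop) [DecidablePred Q] :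
    ∑ x ∈ Finset.univ.filter Q, uniformLaw S g x = (S.filter fun ω => Q (g ω)).card / S.card := by
  classical
  have h := Finset.sum_card_fiberwise_eq_card_filter S (Finset.univ.filter Q) g
  simp only [Finset.mem_filter, Finset.mem_univ, true_and] at h
  simp only [uniformLaw]
  rw [← Finset.sum_div, ← Nat.cast_sum, ← h]

end UniformLaw

lemma exists_forall_pow_four_mul_exp_le {c δ : ℝ} (hc : 0 < c) (hδ : 0 < δ) :
    ∃ C₀ : ℕ, ∀ C : ℕ, C₀ ≤ C → (C : ℝ) ^ 4 * Real.exp (-(c * C)) ≤ δ := by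
  have h1 : Filter.Tendsto (fun C : ℕ => c * (C : ℝ)) Filter.atTop Filter.atTop :=
    tendsto_natCast_atTop_atTop.const_mul_atTop hc
  have h2 := ((Real.tendsto_pow_mul_exp_neg_atTop_nhds_zero 4).comp h1).eventually
    (ge_mem_nhds (show (0 : ℝ) < c ^ 4 * δ by positivity))
  obtain ⟨C₀, hC₀⟩ := Filter.eventually_atTop.1 h2
  refine ⟨C₀, fun C hC => ?_⟩
  have h3 := hC₀ C hC
  simp only [Function.comp_apply, mul_pow, mul_assoc] at h3
  exact le_of_mul_le_mul_left h3 (by positivity)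

/-- The sizes of the two sides of the clusters. -/
def clusterSize (C n : ℕ) {m : ℕ} (i : Fin m) : ℕ :=
  if i.val = 0 then (C - 1) * C + n % ((C - 1) * C) else C

lemma sum_clusterSize {C n : ℕ} (h : (C - 1) * C ≤ n) (hC : 0 < (C - 1) * C) :
    ∑ i : Fin ((n / ((C - 1) * C) - 1) * (C - 1) + 1), clusterSize C n i = n := by
  rw [Fin.sum_univ_succ]
  simp only [clusterSize, Fin.val_zero, if_true, Fin.val_succ, Nat.succ_ne_zero, if_false,
    Finset.sum_const, Finset.card_univ, Fintype.card_fin, smul_eq_mul]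
  obtain ⟨q, hq⟩ : ∃ q, n / ((C - 1) * C) = q + 1 :=
    ⟨n / ((C - 1) * C) - 1, (Nat.sub_add_cancel (Nat.div_pos h hC)).symm⟩
  have h2 := Nat.div_add_mod n ((C - 1) * C)
  rw [hq] at h2 ⊢
  rw [Nat.add_sub_cancel]
  conv_rhs => rw [← h2]
  ring

lemma localLemmaBounds_clusterSize {C n : ℕ} {l : ℝ} (hl0 : 0 ≤ l) (hl : l ≤ 1) (hC : 2 ≤ C)
    (hn : 8 * C ^ 4 ≤ n)
    (hexp : (C : ℝ) ^ 4 * Real.exp (-(l ^ 2 * C)) ≤ 1 / (320 * Real.exp 1)) :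
    LocalLemmaBounds (clusterSize C n (m := (n / ((C - 1) * C) - 1) * (C - 1) + 1)) (Fin n) l
      (16 * C ^ 2 * Real.exp (1 - l ^ 2 * C)) (2 * C ^ 2) := by
  obtain ⟨d, rfl⟩ : ∃ d, C = d + 2 := ⟨C - 2, by omega⟩
  have hN : 0 < (d + 2 - 1) * (d + 2) := Nat.mul_pos (by omega) (by omega)
  have hNle : (d + 2 - 1) * (d + 2) ≤ (d + 2) ^ 2 := by
    rw [sq]
    exact Nat.mul_le_mul_right _ (by omega)
  have h24 : (d + 2) ^ 2 ≤ 8 * (d + 2) ^ 4 := by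
    calc (d + 2) ^ 2 ≤ (d + 2) ^ 4 := Nat.pow_le_pow_right (by omega) (by omega)
      _ ≤ _ := by omega
  have hle : ∀ i : Fin ((n / ((d + 2 - 1) * (d + 2)) - 1) * (d + 2 - 1) + 1),
      clusterSize (d + 2) n i ≤ 2 * (d + 2) ^ 2 := by
    intro i
    have := Nat.mod_lt n hN
    unfold clusterSize
    split_ifs
    · omega
    · nlinarith
  have hge : ∀ i : Fin ((n / ((d + 2 - 1) * (d + 2)) - 1) * (d + 2 - 1) + 1),
      d + 2 ≤ clusterSize (d + 2) n i := by
    intro i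
    unfold clusterSize
    split_ifs
    · have : 1 * (d + 2) ≤ (d + 2 - 1) * (d + 2) := Nat.mul_le_mul_right _ (by omega)
      omega
    · exact le_rfl
  have hpos : 0 < n := lt_of_lt_of_le (by positivity) hn
  refine ⟨hl0, hl, fun i => lt_of_lt_of_le (by omega) (hge i), hle, ?_, ?_, ?_, by positivity, ?_,
    ?_⟩
  · rw [Fintype.card_fin]
    exact sum_clusterSize (hNle.trans (h24.trans hn)) hN
  · rwa [Fintype.card_fin]
  · rw [Fintype.card_fin]
    exact le_trans (le_of_eq (by ring)) hn
  · intro i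
    have h1 : (clusterSize (d + 2) n i : ℝ) ≤ 2 * ((d + 2 : ℕ) : ℝ) ^ 2 := by
      exact_mod_cast hle i
    have h2 : ((d + 2 : ℕ) : ℝ) ≤ clusterSize (d + 2) n i := by exact_mod_cast hge i
    calc _ ≤ 8 * (2 * ((d + 2 : ℕ) : ℝ) ^ 2) * Real.exp (1 - l ^ 2 * ((d + 2 : ℕ) : ℝ)) := by
          gcongr
      _ = _ := by ring
  · set c : ℝ := ((d + 2 : ℕ) : ℝ) with hc
    have hc1 : 1 ≤ c := by
      rw [hc]
      push_cast
      linarith [(Nat.cast_nonneg d : (0 : ℝ) ≤ d)]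
    have h1 : 1 ≤ c ^ 2 := one_le_pow₀ hc1
    rw [sub_eq_add_neg, Real.exp_add]
    simp only [Nat.cast_mul, Nat.cast_pow, Nat.cast_ofNat, ← hc]
    rw [le_div_iff₀ (by positivity)] at hexp
    have h2 : (1 + 2 * (2 * c ^ 2)) * (16 * c ^ 2) ≤ 80 * c ^ 4 := by nlinarith
    calc _ = ((1 + 2 * (2 * c ^ 2)) * (16 * c ^ 2)) *
          (Real.exp 1 * Real.exp (-(l ^ 2 * c))) := by ring
      _ ≤ (80 * c ^ 4) * (Real.exp 1 * Real.exp (-(l ^ 2 * c))) := by gcongr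
      _ ≤ _ := by linarith

open Classical in
theorem random_clustering_bipartite (ε : ℝ) (hε : 0 < ε) :
    ∃ C₀ : ℕ, ∀ C : ℕ, C₀ ≤ C →
    ∃ C'₀ : ℝ, ∀ C' : ℝ, C'₀ ≤ C' →
    ∃ n₀ : ℕ, ∀ n : ℕ, n₀ ≤ n →
    -- `Adj` is the bipartite graph `G = (V₁, V₂)` with `V₁ = V₂ = Fin n`
    ∀ Adj : Fin n → Fin n → Prop,
      (∀ a b : Fin n,
        (1 + ε) * n ≤ ((Finset.univ.filter fun b' => Adj a b').card : ℝ) +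
          ((Finset.univ.filter fun a' => Adj a' b).card : ℝ)) →
    ∃ m : ℕ, 0 < m ∧
    -- a distribution over partitions `U` of `V(G)`; part `i` is the pair
    -- `((U i).1, (U i).2) = (U_i ∩ V₁, U_i ∩ V₂)`
    ∃ μ : (Fin m → Finset (Fin n) × Finset (Fin n)) → ℝ,
      (∀ x, 0 ≤ μ x) ∧ (∑ x, μ x = 1) ∧
      (∀ U, μ U ≠ 0 →
        -- `U` is a partition of `V(G) = V₁ ⊔ V₂`
        ((∀ i j : Fin m, i ≠ j → Disjoint (U i).1 (U j).1 ∧ Disjoint (U i).2 (U j).2) ∧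
          (Finset.univ.biUnion fun i => (U i).1) = Finset.univ ∧
          (Finset.univ.biUnion fun i => (U i).2) = Finset.univ) ∧
        -- (1) sizes: `|U_i ∩ V₁| = |U_i ∩ V₂|`, `|U_i| = 2C` for `i ≠ 1`, and the size of `U_1`
        (∀ i : Fin m, (U i).1.card = (U i).2.card) ∧
        (∀ i : Fin m, i.val ≠ 0 → (U i).1.card + (U i).2.card = 2 * C) ∧
        (∀ i : Fin m, i.val = 0 →
          (U i).1.card + (U i).2.card = 2 * (C - 1) * C + (2 * n) % (2 * (C - 1) * C)) ∧
        -- (2) `δ_{1}(G[U_i]) + δ_{2}(G[U_i]) ≥ (1 + ε/3)|U_i|/2`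
        (∀ i : Fin m, ∀ v ∈ (U i).1, ∀ u ∈ (U i).2,
          (1 + ε / 3) * (((U i).1.card + (U i).2.card : ℝ) / 2) ≤
            (((U i).2.filter fun b => Adj v b).card : ℝ) +
              (((U i).1.filter fun a => Adj a u).card : ℝ))) ∧
      -- (3) spreadness
      (∀ (s : ℕ) (y : Fin s → Fin n ⊕ Fin n), Function.Injective y →
        ∀ f : Fin s → Fin m,
          ∑ x ∈ Finset.univ.filter
              (fun U : Fin m → Finset (Fin n) × Finset (Fin n) =>
                ∀ i, (match y i with
                  | Sum.inl a => a ∈ (U (f i)).1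
                  | Sum.inr b => b ∈ (U (f i)).2)),
            μ x ≤ (C' / n) ^ s) := by
  set l : ℝ := min (ε / 6) 1 with hl
  have hl0 : 0 < l := lt_min (by positivity) one_pos
  have hlε : l ≤ ε / 6 := min_le_left _ _
  obtain ⟨C₀, hC₀⟩ := exists_forall_pow_four_mul_exp_le (c := l ^ 2)
    (δ := 1 / (320 * Real.exp 1)) (by positivity) (by positivity)
  refine ⟨max 2 C₀, fun C hC => ⟨4 * Real.exp 1 * ((2 * C ^ 2 : ℕ) : ℝ), fun C' hC' =>
    ⟨8 * C ^ 4, fun n hn Adj hAdj => ?_⟩⟩⟩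
  have hC2 : 2 ≤ C := (le_max_left _ _).trans hC
  have H := localLemmaBounds_clusterSize hl0.le (min_le_right _ _) hC2 hn
    (hC₀ C ((le_max_right _ _).trans hC))
  set m := (n / ((C - 1) * C) - 1) * (C - 1) + 1 with hm
  set k : Fin m → ℕ := clusterSize C n with hk
  have hn0 : (0 : ℝ) < n := by
    have := H.card_pos
    rw [Fintype.card_fin] at this
    exact_mod_cast this
  set S := goodTuples k Adj (2 * l) with hS
  have hS0 : (0 : ℝ) < S.card := by exact_mod_cast H.card_goodTuples_pos
  let g : (Bool → (Σ i, Fin (k i)) ≃ Fin n) → Fin m → Finset (Fin n) × Finset (Fin n) :=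
    fun ω i => (clusterSide ω true i, clusterSide ω false i)
  refine ⟨m, Nat.succ_pos _, uniformLaw S g, uniformLaw_nonneg, ?_, ?_, ?_⟩
  · have := sum_filter_uniformLaw (S := S) (g := g) fun _ => True
    simpa [hS0.ne'] using this
  · intro U hU
    obtain ⟨ω, hω, rfl⟩ := exists_of_uniformLaw_ne_zero hU
    have hdisj : ∀ b (i j : Fin m), i ≠ j →
        Disjoint (clusterSide ω b i) (clusterSide ω b j) := fun b i j hij =>
      Finset.disjoint_left.2 fun a hi hj =>
        hij ((mem_clusterSide.1 hi).symm.trans (mem_clusterSide.1 hj))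
    have hcover : ∀ b, (Finset.univ.biUnion fun i => clusterSide ω b i) = Finset.univ := fun b =>
      Finset.eq_univ_of_forall fun a =>
        Finset.mem_biUnion.2 ⟨_, Finset.mem_univ _, mem_clusterSide.2 rfl⟩
    refine ⟨⟨fun i j hij => ⟨hdisj _ i j hij, hdisj _ i j hij⟩, hcover _, hcover _⟩, ?_, ?_, ?_, ?_⟩
    · intro i
      simp only [g, card_clusterSide]
    · intro i hi
      simp only [g, card_clusterSide, hk, clusterSize, if_neg hi]
      ring
    · intro i hi
      simp only [g, card_clusterSide, hk, clusterSize, if_pos hi]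
      rw [mul_assoc 2, Nat.mul_mod_mul_left]
      ring
    · intro i v hv u hu
      have h1 := le_card_filter_clusterSide hω true i hv
      have h2 := le_card_filter_clusterSide hω false i hu
      have h3 := hAdj v u
      simp only [neighbors, Bool.not_true, Bool.not_false, true_and, false_and, or_false,
        false_or, Bool.true_eq_false, Bool.false_eq_true, Finset.mem_filter, Finset.mem_univ,
        Fintype.card_fin] at h1 h2
      simp only [g, card_clusterSide]
      refine le_trans ?_ (add_le_add h1 h2)
      rw [← add_mul]
      have h4 : 1 + ε ≤ ((Finset.univ.filter fun b' => Adj v b').card : ℝ) / n +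
          ((Finset.univ.filter fun a' => Adj a' u).card : ℝ) / n := by
        rwa [← add_div, le_div_iff₀ hn0]
      calc _ = (1 + ε / 3) * (k i : ℝ) := by ring
        _ ≤ _ := mul_le_mul_of_nonneg_right (by linarith) (Nat.cast_nonneg _)
  · intro s y hy f
    rw [sum_filter_uniformLaw, div_le_iff₀ hS0]
    let side : Fin n ⊕ Fin n → Bool := Sum.elim (fun _ => true) fun _ => false
    let val : Fin n ⊕ Fin n → Fin n := Sum.elim id id
    have hinj : Function.Injective fun t => (side (y t), val (y t)) := by
      have : Function.Injective fun z => (side z, val z) := by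
        rintro (a | a) (b | b) h <;> simp_all [side, val]
      exact this.comp hy
    have h1 := H.card_goodTuples_filter_le (Adj := Adj) (fun t => side (y t))
      (fun t => val (y t)) hinj f
    rw [Fintype.card_fin] at h1
    have h2 : (S.filter fun ω => ∀ i, (match y i with
          | Sum.inl a => a ∈ (g ω (f i)).1
          | Sum.inr b => b ∈ (g ω (f i)).2)) =
        S.filter fun ω => ∀ t, ((ω (side (y t))).symm (val (y t))).1 = f t := by
      refine Finset.filter_congr fun ω _ => forall_congr' fun t => ?_
      rcases y t with a | a <;> simp [g, side, val, mem_clusterSide]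
    rw [h2, div_pow, div_mul_eq_mul_div, le_div_iff₀ (by positivity)]
    refine h1.trans ?_
    gcongr
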